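/- arXiv:2112.09877 — 3 statements merged into one kernel-verified Lean document; each statement's English description precedes it below -/
import Mathlib

section
/- Let A be a nowhere scattered C*-algebra and let B₀ ⊆ A be a separable sub-C*-algebra. Then there exists a separable, nowhere scattered sub-C*-algebra B ⊆ A with B₀ ⊆ B. -/
section NowhereScattered

variable {A : Type*} [NonUnitalRing A] [Module ℂ A] [StarRing A] [PartialOrder A]
  [TopologicalSpace A]

/-- A sub-*-algebra `B` of `A` is hereditary if `0 ≤ a ≤ b` with `b ∈ B` implies `a ∈ B`. -/
def NonUnitalStarSubalgebra.Hereditary (B : NonUnitalStarSubalgebra ℂ A) : Prop :=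
  ∀ b ∈ B, ∀ a : A, 0 ≤ a → a ≤ b → a ∈ B

/-- A sub-*-algebra admits a character if there is a nonzero *-algebra homomorphism to `ℂ`. -/
def NonUnitalStarSubalgebra.AdmitsCharacter (B : NonUnitalStarSubalgebra ℂ A) : Prop :=
  ∃ φ : B →⋆ₙₐ[ℂ] ℂ, φ ≠ 0

end NowhereScattered

/-- A C*-algebra is nowhere scattered if no hereditary sub-C*-algebra of it admits a
character. -/
def NowhereScattered (A : Type*) [NonUnitalRing A] [Module ℂ A] [StarRing A] [PartialOrder A]
    [TopologicalSpace A] : Prop :=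
  ∀ B : NonUnitalStarSubalgebra ℂ A, IsClosed (B : Set A) → B.Hereditary →
    ¬ B.AdmitsCharacter

theorem Ideal.exists_mul_sub_one_mem_or_exists_algHom_eq_zero {U : Type*} [NormedRing U]
    [NormedAlgebra ℂ U] [CompleteSpace U] (J : Ideal U) [J.IsTwoSided]
    (hJ : IsClosed (J : Set U)) (hcomm : ∀ x y, x * y - y * x ∈ J) (u : U) :
    (∃ v, v * u - 1 ∈ J) ∨ ∃ χ : U →ₐ[ℂ] ℂ, χ u = 0 := by
  have : IsClosed (J : Set U) := hJ
  let N : NormedAddCommGroup (U ⧸ J) := Submodule.Quotient.normedAddCommGroup J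
  let NS : NormedSpace ℂ (U ⧸ J) := Submodule.Quotient.normedSpace J ℂ
  let C : NormedCommRing (U ⧸ J) :=
    { N, Ideal.Quotient.ring J with
      mul_comm := by
        rintro ⟨x⟩ ⟨y⟩
        exact Ideal.Quotient.eq.2 (hcomm x y)
      norm_mul_le := fun x y ↦ le_of_forall_pos_le_add fun ε hε ↦ by
        have := ((Metric.nhds_basis_ball.prod_nhds Metric.nhds_basis_ball).tendsto_iff Metric.nhds_basis_ball).mp
          (continuous_mul.tendsto (‖x‖, ‖y‖)) ε hε
        simp only [Set.mem_prod, Metric.mem_ball, and_imp, Prod.forall, Prod.exists] at this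
        rcases this with ⟨ε₁, ε₂, ⟨h₁, h₂⟩, h⟩
        obtain ⟨a, rfl, ha⟩ := Submodule.Quotient.norm_mk_lt x h₁
        obtain ⟨b, rfl, hb⟩ := Submodule.Quotient.norm_mk_lt y h₂
        have hle : ∀ r : U, ‖(Submodule.Quotient.mk r : U ⧸ J)‖ ≤ ‖r‖ :=
          Submodule.Quotient.norm_mk_le J
        simp only [dist, abs_sub_lt_iff] at h
        specialize h ‖a‖ ‖b‖ ⟨by linarith, by linarith [hle a]⟩
          ⟨by linarith, by linarith [hle b]⟩
        calc ‖(Submodule.Quotient.mk (a * b) : U ⧸ J)‖ ≤ ‖a * b‖ := hle _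
          _ ≤ ‖a‖ * ‖b‖ := norm_mul_le a b
          _ ≤ _ := (sub_lt_iff_lt_add'.mp h.1).le }
  let NA : NormedAlgebra ℂ (U ⧸ J) := { NS, (Ideal.Quotient.algebra ℂ : Algebra ℂ (U ⧸ J)) with }
  have : CompleteSpace (U ⧸ J) := Submodule.Quotient.completeSpace J
  by_cases hu : IsUnit (Ideal.Quotient.mk J u)
  · left
    obtain ⟨w, hw⟩ := isUnit_iff_exists_inv'.1 hu
    obtain ⟨v, rfl⟩ := Ideal.Quotient.mk_surjective w
    exact ⟨v, Ideal.Quotient.eq.1 (by simpa using hw)⟩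
  · right
    have : Nontrivial (U ⧸ J) := by
      by_contra h
      rw [not_nontrivial_iff_subsingleton] at h
      exact hu (isUnit_of_subsingleton _)
    obtain ⟨χ, hχ⟩ := WeakDual.CharacterSpace.exists_apply_eq_zero hu
    exact ⟨(AlgHomClass.toAlgHom χ : (U ⧸ J) →ₐ[ℂ] ℂ).comp (Ideal.Quotient.mkₐ ℂ J), hχ⟩

theorem exists_mul_one_sub_inr_mem_closure {H : Type*} [NonUnitalCStarAlgebra H]
    (hH : ∀ φ : H →⋆ₙₐ[ℂ] ℂ, φ = 0) (b : H) :
    ∃ v : Unitization ℂ H, v * (1 - (b : Unitization ℂ H)) - 1 ∈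
      closure (Ideal.span {c : Unitization ℂ H | ∃ x y z, c = (x * y - y * x) * z} :
        Set (Unitization ℂ H)) := by
  set S := {c : Unitization ℂ H | ∃ x y z, c = (x * y - y * x) * z}
  have h2 : ∀ a ∈ Ideal.span S, ∀ r, a * r ∈ Ideal.span S := fun a ha r ↦ by
    induction ha using Submodule.span_induction with
    | mem x h =>
      obtain ⟨x, y, z, rfl⟩ := h
      exact Ideal.subset_span ⟨x, y, z * r, mul_assoc _ _ _⟩
    | zero => simp
    | add x y _ _ hx hy => rw [add_mul]; exact add_mem hx hy
    | smul a x _ hx => rw [smul_mul_assoc]; exact Submodule.smul_mem _ _ hx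
  have : (Ideal.span S).closure.IsTwoSided := ⟨fun {a} r ha ↦
    map_mem_closure (f := (· * r)) (by fun_prop) ha fun x hx ↦ h2 x hx r⟩
  rcases Ideal.exists_mul_sub_one_mem_or_exists_algHom_eq_zero (Ideal.span S).closure
    isClosed_closure (fun x y ↦ subset_closure (Ideal.subset_span ⟨x, y, 1, (mul_one _).symm⟩))
    (1 - (b : Unitization ℂ H)) with ⟨v, hv⟩ | ⟨χ, hχ⟩
  · exact ⟨v, hv⟩
  · exfalso
    let ψ : Unitization ℂ H →⋆ₐ[ℂ] ℂ := { χ with map_star' := map_star χ }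
    have := DFunLike.congr_fun
      (hH ((ψ : Unitization ℂ H →⋆ₙₐ[ℂ] ℂ).comp (Unitization.inrNonUnitalStarAlgHom ℂ H))) b
    have h0 : χ (b : Unitization ℂ H) = 0 := this
    simp [h0] at hχ

open Filter Topology in
theorem CStarAlgebra.exists_seq_mul_eq_one_sub {U : Type*} [CStarAlgebra U] [PartialOrder U]
    [StarOrderedRing U] {b : U} (hb : 0 ≤ b) :
    ∃ u v : ℕ → U, (∀ n, star (u n) = u n) ∧ (∀ n, ‖u n‖ ≤ 1) ∧ (∀ n, b * v n = 1 - u n) ∧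
      (∀ n, v n * b = 1 - u n) ∧ Tendsto (fun n ↦ b * u n) atTop (𝓝 0) := by
  have hspec : ∀ t ∈ spectrum ℝ b, 0 ≤ t := fun t ht ↦ spectrum_nonneg_of_nonneg hb ht
  let f : ℕ → ℝ → ℝ := fun n t ↦ (1 + n * t)⁻¹
  let g : ℕ → ℝ → ℝ := fun n t ↦ n * (1 + n * t)⁻¹
  have hne : ∀ (n : ℕ), ∀ t ∈ spectrum ℝ b, 0 < 1 + n * t := fun n t ht ↦ by
    have := hspec t ht
    positivity
  have hf : ∀ n, ContinuousOn (f n) (spectrum ℝ b) := fun n ↦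
    ContinuousOn.inv₀ (by fun_prop) fun t ht ↦ (hne n t ht).ne'
  have hg : ∀ n, ContinuousOn (g n) (spectrum ℝ b) := fun n ↦
    continuousOn_const.mul (hf n)
  have hbv : ∀ n, b * cfc (g n) b = 1 - cfc (f n) b := fun n ↦ by
    have : cfc (fun t : ℝ ↦ t * g n t) b = b * cfc (g n) b := by
      rw [cfc_mul (fun t : ℝ ↦ t) (g n) b (by fun_prop) (hg n), cfc_id' ℝ b]
    rw [← this, ← cfc_one ℝ b, ← cfc_sub _ _ _ (by fun_prop) (hf n)]
    refine cfc_congr fun t ht ↦ ?_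
    have := (hne n t ht).ne'
    simp only [f, g, Pi.one_apply]
    rw [eq_sub_iff_add_eq, ← mul_assoc, ← add_one_mul, mul_comm t, add_comm, mul_inv_cancel₀ this]
  refine ⟨fun n ↦ cfc (f n) b, fun n ↦ cfc (g n) b, fun n ↦ (cfc_predicate (f n) b).star_eq,
    fun n ↦ norm_cfc_le zero_le_one fun t ht ↦ ?_, hbv, fun n ↦ ?_,
    squeeze_zero_norm' ?_ tendsto_one_div_atTop_nhds_zero_nat⟩
  · have h0 := hspec t ht
    have h1 := hne n t ht
    rw [Real.norm_of_nonneg (by positivity)]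
    exact inv_le_one_of_one_le₀ (by nlinarith [(Nat.cast_nonneg n : (0 : ℝ) ≤ n)])
  · rw [← hbv]
    simpa only [cfc_id' ℝ b] using (cfc_commute_cfc (g n) (fun t : ℝ ↦ t) b).eq
  · filter_upwards [eventually_gt_atTop 0] with n hn
    have : cfc (fun t : ℝ ↦ t * f n t) b = b * cfc (f n) b := by
      rw [cfc_mul (fun t : ℝ ↦ t) (f n) b (by fun_prop) (hf n), cfc_id' ℝ b]
    rw [← this]
    refine norm_cfc_le (by positivity) fun t ht ↦ ?_
    have h0 := hspec t ht
    have h1 := hne n t ht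
    have h2 : (0 : ℝ) < n := by exact_mod_cast hn
    have h3 : 0 ≤ f n t := by positivity
    rw [Real.norm_of_nonneg (by positivity)]
    simp only [f]
    rw [← div_eq_mul_inv, div_le_div_iff₀ h1 h2]
    linarith

open Filter Topology Unitization in
theorem NonUnitalStarSubalgebra.exists_hereditary_mem_closure_range {A : Type*}
    [NonUnitalCStarAlgebra A] [PartialOrder A] [StarOrderedRing A] {b : A} (hb : 0 ≤ b) :
    ∃ H : NonUnitalStarSubalgebra ℂ A, IsClosed (H : Set A) ∧ H.Hereditary ∧ b ∈ H ∧
      ∀ x ∈ H, x ∈ closure (Set.range fun y ↦ b * y * b) := by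
  have hbU : 0 ≤ (b : Unitization ℂ A) := inr_nonneg_iff.2 hb
  obtain ⟨u, v, hu, hu1, hbv, hvb, hbu⟩ := CStarAlgebra.exists_seq_mul_eq_one_sub hbU
  let L : Set A := {x | Tendsto (fun n ↦ (x : Unitization ℂ A) * u n) atTop (𝓝 0)}
  have hL : IsClosed L := by
    refine isClosed_of_closure_subset fun x hx ↦ ?_
    refine Metric.tendsto_atTop.2 fun ε hε ↦ ?_
    obtain ⟨y, hy, hxy⟩ := Metric.mem_closure_iff.1 hx (ε / 2) (by positivity)
    obtain ⟨N, hN⟩ := Metric.tendsto_atTop.1 hy (ε / 2) (by positivity)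
    refine ⟨N, fun n hn ↦ ?_⟩
    have h1 := hN n hn
    rw [dist_zero_right] at h1 ⊢
    have h2 : ‖((x - y : A) : Unitization ℂ A) * u n‖ ≤ dist x y := by
      refine (norm_mul_le _ _).trans ?_
      rw [norm_inr, dist_eq_norm]
      exact mul_le_of_le_one_right (norm_nonneg _) (hu1 n)
    have h3 : (x : Unitization ℂ A) * u n = ((x - y : A) : Unitization ℂ A) * u n + y * u n := by
      rw [inr_sub, ← add_mul, sub_add_cancel]
    rw [h3]
    linarith [norm_add_le (((x - y : A) : Unitization ℂ A) * u n) (y * u n)]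
  have hLmul : ∀ x, ∀ y ∈ L, x * y ∈ L := fun x y hy ↦ by
    have : Tendsto (fun n ↦ (x : Unitization ℂ A) * (y * u n)) atTop (𝓝 (x * 0)) :=
      Tendsto.const_mul _ hy
    simpa [L, mul_assoc] using this
  have hLadd : ∀ x ∈ L, ∀ y ∈ L, x + y ∈ L := fun x hx y hy ↦ by
    have := Tendsto.add hx hy
    simpa [L, add_mul] using this
  have hLzero : (0 : A) ∈ L := by simp [L]
  have hLsmul : ∀ (c : ℂ), ∀ x ∈ L, c • x ∈ L := fun c x hx ↦ by
    have := Tendsto.const_smul hx c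
    simpa [L] using this
  obtain ⟨H, hmem⟩ : ∃ H : NonUnitalStarSubalgebra ℂ A, ∀ x, x ∈ H ↔ x ∈ L ∧ star x ∈ L := ⟨
    { carrier := {x | x ∈ L ∧ star x ∈ L}
      add_mem' := fun hx hy ↦ ⟨hLadd _ hx.1 _ hy.1, by
        rw [star_add]; exact hLadd _ hx.2 _ hy.2⟩
      zero_mem' := ⟨hLzero, by rwa [star_zero]⟩
      mul_mem' := fun hx hy ↦ ⟨hLmul _ _ hy.1, by rw [star_mul]; exact hLmul _ _ hx.2⟩
      smul_mem' := fun c x hx ↦ ⟨hLsmul _ _ hx.1, by rw [star_smul]; exact hLsmul _ _ hx.2⟩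
      star_mem' := fun hx ↦ ⟨hx.2, by rw [star_star]; exact hx.1⟩ }, fun _ ↦ Iff.rfl⟩
  have hH : ∀ x, IsSelfAdjoint x → x ∈ L → x ∈ H := fun x hs hx ↦ by
    rw [hmem, hs.star_eq]
    exact ⟨hx, hx⟩
  have hHc : IsClosed (H : Set A) := by
    convert hL.inter (hL.preimage continuous_star)
    ext x
    exact hmem x
  refine ⟨H, hHc, ?_, ?_, ?_⟩
  · intro h hh c hc hch
    refine hH c hc.isSelfAdjoint ?_
    have hs : star (CFC.sqrt c) = CFC.sqrt c := (CFC.sqrt_nonneg c).isSelfAdjoint.star_eq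
    have hsq : CFC.sqrt c * CFC.sqrt c = c := CFC.sqrt_mul_sqrt_self c hc
    rw [← hsq]
    refine hLmul _ _ ?_
    have key : ∀ n, ‖((CFC.sqrt c : A) : Unitization ℂ A) * u n‖ ^ 2 ≤
        ‖(h : Unitization ℂ A) * u n‖ := fun n ↦ by
      have h1 : star (((CFC.sqrt c : A) : Unitization ℂ A) * u n) *
          (((CFC.sqrt c : A) : Unitization ℂ A) * u n) = star (u n) * c * u n := by
        conv_rhs => rw [← hsq]
        simp only [star_mul, ← inr_star, hs, inr_mul, mul_assoc]
      rw [sq, ← CStarRing.norm_star_mul_self, h1]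
      have h2 : star (u n) * c * u n ≤ star (u n) * h * u n :=
        star_left_conjugate_le_conjugate ((inr_le_iff _ _ hc.isSelfAdjoint
          (hc.trans hch).isSelfAdjoint).2 hch) _
      refine (CStarAlgebra.norm_le_norm_of_nonneg_of_le
        (star_left_conjugate_nonneg (inr_nonneg_iff.2 hc) _) h2).trans ?_
      rw [mul_assoc]
      refine (norm_mul_le _ _).trans (mul_le_of_le_one_left (norm_nonneg _) ?_)
      rw [norm_star]
      exact hu1 n
    have h0 : Tendsto (fun n ↦ ‖((CFC.sqrt c : A) : Unitization ℂ A) * u n‖ ^ 2) atTop (𝓝 0) :=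
      squeeze_zero (fun n ↦ by positivity) key (tendsto_zero_iff_norm_tendsto_zero.1 ((hmem h).1 hh).1)
    refine tendsto_zero_iff_norm_tendsto_zero.2 ?_
    have := h0.sqrt
    simpa using this
  · exact hH b hb.isSelfAdjoint hbu
  · intro x hx
    have hy : ∀ n, ∃ y : A, (y : Unitization ℂ A) = v n * x * v n := fun n ↦
      ⟨(v n * x * v n).snd, by ext <;> simp⟩
    choose y hy using hy
    refine mem_closure_of_tendsto (b := atTop) (f := fun n ↦ b * y n * b) ?_
      (Eventually.of_forall fun n ↦ ⟨y n, rfl⟩)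
    rw [(isometry_inr (𝕜 := ℂ) (A := A)).isEmbedding.tendsto_nhds_iff]
    have hxu : Tendsto (fun n ↦ (x : Unitization ℂ A) * u n) atTop (𝓝 0) := ((hmem x).1 hx).1
    have hux : Tendsto (fun n ↦ u n * (x : Unitization ℂ A)) atTop (𝓝 0) := by
      have : Tendsto (fun n ↦ star (((star x : A) : Unitization ℂ A) * u n)) atTop (𝓝 (star 0)) :=
        Tendsto.star ((hmem x).1 hx).2
      simpa [hu] using this
    have huxu : Tendsto (fun n ↦ u n * (x : Unitization ℂ A) * u n) atTop (𝓝 0) :=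
      squeeze_zero_norm (fun n ↦ (norm_mul_le _ _).trans
        (mul_le_of_le_one_right (norm_nonneg _) (hu1 n)))
        (tendsto_zero_iff_norm_tendsto_zero.1 hux)
    have h3 : Tendsto (fun n ↦ (x : Unitization ℂ A) - u n * x - x * u n + u n * x * u n)
        atTop (𝓝 (x - 0 - 0 + 0)) := ((tendsto_const_nhds.sub hux).sub hxu).add huxu
    simp only [sub_zero, add_zero] at h3
    refine h3.congr fun n ↦ ?_
    have : (b : Unitization ℂ A) * (v n * x * v n) * b = (b * v n) * x * (v n * b) := by
      simp only [mul_assoc]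
    simp only [Function.comp, inr_mul, hy, this, hbv, hvb]
    noncomm_ring

theorem Subsemigroup.countable_closure {M : Type*} [Semigroup M] {s : Set M} (hs : s.Countable) :
    (Subsemigroup.closure s : Set M).Countable := by
  have : Countable s := hs
  have : Countable (FreeSemigroup s) :=
    Function.Injective.countable (f := fun x : FreeSemigroup s ↦ (x.head, x.tail)) fun x y h ↦ by
      cases x; cases y; simp_all
  refine (Set.countable_range (FreeSemigroup.lift ((↑) : s → M))).mono fun x hx ↦ ?_
  induction hx using Subsemigroup.closure_induction with
  | mem x hx => exact ⟨FreeSemigroup.of ⟨x, hx⟩, by simp⟩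
  | mul x y _ _ hx hy =>
    obtain ⟨u, rfl⟩ := hx
    obtain ⟨v, rfl⟩ := hy
    exact ⟨u * v, map_mul _ _ _⟩

open TopologicalSpace in
theorem NonUnitalStarAlgebra.isSeparable_adjoin {A : Type*} [NonUnitalCStarAlgebra A] {s : Set A}
    (hs : s.Countable) : IsSeparable (NonUnitalStarAlgebra.adjoin ℂ s : Set A) := by
  have h : (s ∪ star s).Countable := by
    refine hs.union ?_
    rw [← Set.image_star]
    exact hs.image _
  have := (Subsemigroup.countable_closure h).isSeparable.span (R := ℂ)
  rwa [← NonUnitalStarAlgebra.adjoin_eq_span] at this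

open TopologicalSpace in
theorem NonUnitalStarSubalgebra.exists_isSeparable_witnesses {A W : Type*}
    [NonUnitalCStarAlgebra A] (supp : W → Set A) (hsupp : ∀ w, (supp w).Countable)
    (R : A → W → Prop) (hopen : ∀ w, IsOpen {a | R a w}) (hex : ∀ a, ∃ w, R a w)
    (B₀ : NonUnitalStarSubalgebra ℂ A) (hB₀ : IsSeparable (B₀ : Set A)) :
    ∃ B : NonUnitalStarSubalgebra ℂ A, IsClosed (B : Set A) ∧ IsSeparable (B : Set A) ∧
      B₀ ≤ B ∧ ∀ a ∈ B, ∃ w, supp w ⊆ B ∧ R a w := by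
  have step : ∀ S : {S : NonUnitalStarSubalgebra ℂ A // IsSeparable (S : Set A)},
      ∃ T : {S : NonUnitalStarSubalgebra ℂ A // IsSeparable (S : Set A)}, S.1 ≤ T.1 ∧
        ∀ a ∈ S.1, ∀ w, ∀ r > 0, Metric.ball a r ⊆ {a | R a w} →
          ∃ w', supp w' ⊆ T.1 ∧ Metric.ball a (r / 4) ⊆ {a | R a w'} := by
    rintro ⟨S, hS⟩
    obtain ⟨D, hDS, hD, hSD⟩ := hS.exists_countable_dense_subset
    have : Countable D := hD
    have hW : Nonempty W := ⟨(hex 0).choose⟩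
    choose! f hf using fun (p : D × ℚ) (h : ∃ w, Metric.ball p.1.1 p.2 ⊆ {a | R a w}) ↦ h
    have hC : (D ∪ ⋃ p, supp (f p)).Countable :=
      hD.union (Set.countable_iUnion fun p ↦ hsupp _)
    refine ⟨⟨(NonUnitalStarAlgebra.adjoin ℂ (D ∪ ⋃ p, supp (f p))).topologicalClosure,
      (NonUnitalStarAlgebra.isSeparable_adjoin hC).closure⟩, ?_, ?_⟩
    · intro x hx
      exact closure_mono (Set.subset_union_left.trans (NonUnitalStarAlgebra.subset_adjoin ℂ _))
        (hSD hx)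
    · intro a ha w r hr hw
      obtain ⟨d, hd, had⟩ := Metric.mem_closure_iff.1 (hSD ha) (r / 4) (by positivity)
      obtain ⟨q, hq₁, hq₂⟩ := exists_rat_btwn (show r / 2 < 3 * r / 4 by linarith)
      refine ⟨f (⟨d, hd⟩, q), ?_, ?_⟩
      · refine Set.Subset.trans ?_ ((Set.subset_union_right.trans
          (NonUnitalStarAlgebra.subset_adjoin ℂ _)).trans subset_closure)
        exact Set.subset_iUnion (fun p ↦ supp (f p)) _
      · refine (Metric.ball_subset_ball' ?_).trans
          (hf (⟨d, hd⟩, q) ⟨w, (Metric.ball_subset_ball' ?_).trans hw⟩)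
        · dsimp only; linarith
        · dsimp only; rw [dist_comm]; linarith
  choose next hle hnext using step
  let S : ℕ → {S : NonUnitalStarSubalgebra ℂ A // IsSeparable (S : Set A)} :=
    fun n ↦ next^[n] ⟨B₀, hB₀⟩
  have hS : ∀ n, S (n + 1) = next (S n) := fun n ↦ Function.iterate_succ_apply' _ _ _
  have hmono : Monotone fun n ↦ (S n).1 := monotone_nat_of_le_succ fun n ↦ by
    rw [hS]; exact hle _
  have hcoe := NonUnitalStarSubalgebra.coe_iSup_of_directed hmono.directed_le
  refine ⟨(⨆ n, (S n).1).topologicalClosure, isClosed_closure, ?_, ?_, ?_⟩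
  · refine IsSeparable.closure ?_
    change IsSeparable ((⨆ n, (S n).1 : NonUnitalStarSubalgebra ℂ A) : Set A)
    rw [hcoe]
    exact .iUnion fun n ↦ (S n).2
  · exact (le_iSup (fun n ↦ (S n).1) 0).trans (NonUnitalStarSubalgebra.le_topologicalClosure _)
  · intro a ha
    obtain ⟨w, hw⟩ := hex a
    obtain ⟨r, hr, hball⟩ := Metric.isOpen_iff.1 (hopen w) a hw
    obtain ⟨x, hx, hax⟩ := Metric.mem_closure_iff.1 (show a ∈ closure
      ((⨆ n, (S n).1 : NonUnitalStarSubalgebra ℂ A) : Set A) from ha) (r / 8) (by positivity)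
    rw [hcoe] at hx
    obtain ⟨n, hn⟩ := Set.mem_iUnion.1 hx
    obtain ⟨w', hw', hball'⟩ := hnext (S n) x hn w (r / 2) (by positivity)
      ((Metric.ball_subset_ball' (by rw [dist_comm]; linarith)).trans hball)
    refine ⟨w', hw'.trans ?_, hball' (by rw [Metric.mem_ball]; linarith)⟩
    rw [← hS]
    exact fun y hy ↦ subset_closure (le_iSup (fun n ↦ (S n).1) (n + 1) hy)

theorem Unitization.commutator_eq_inr {R A : Type*} [CommRing R] [NonUnitalRing A] [Module R A]
    [IsScalarTower R A A] [SMulCommClass R A A] (x y : Unitization R A) :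
    x * y - y * x = Unitization.inr (x.snd * y.snd - y.snd * x.snd) := by
  rw [sub_eq_iff_eq_add]
  ext
  · simp [-Unitization.inr_sub, -Unitization.inr_mul, mul_comm]
  · simp [-Unitization.inr_sub, -Unitization.inr_mul]
    abel

/-- The element `(b p b) [b x b, b y b] (b q b)` attached to the quadruple `w = (p, x, y, q)`. -/
def conjCommutator {A : Type*} [NonUnitalRing A] (b : A) (w : A × A × A × A) : A :=
  b * w.1 * b * (b * w.2.1 * b * (b * w.2.2.1 * b) - b * w.2.2.1 * b * (b * w.2.1 * b)) *
    (b * w.2.2.2 * b)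

theorem closure_range_list_sum_conjCommutator {A : Type*} [NonUnitalCStarAlgebra A] (b : A)
    {p x y q : A} (hp : p ∈ closure (Set.range fun z ↦ b * z * b))
    (hx : x ∈ closure (Set.range fun z ↦ b * z * b))
    (hy : y ∈ closure (Set.range fun z ↦ b * z * b))
    (hq : q ∈ closure (Set.range fun z ↦ b * z * b)) :
    p * (x * y - y * x) * q ∈
      closure (Set.range fun l : List (A × A × A × A) ↦ (l.map (conjCommutator b)).sum) := by
  have h : (p, x, y, q) ∈ closure ((Set.range fun z ↦ b * z * b) ×ˢ
      (Set.range fun z ↦ b * z * b) ×ˢ (Set.range fun z ↦ b * z * b) ×ˢ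
      (Set.range fun z ↦ b * z * b)) := by
    simp only [closure_prod_eq]
    exact ⟨hp, hx, hy, hq⟩
  refine map_mem_closure
    (f := fun w : A × A × A × A ↦ w.1 * (w.2.1 * w.2.2.1 - w.2.2.1 * w.2.1) * w.2.2.2)
    (by fun_prop) h ?_
  rintro ⟨-, -, -, -⟩ ⟨⟨p, rfl⟩, ⟨x, rfl⟩, ⟨y, rfl⟩, ⟨q, rfl⟩⟩
  exact ⟨[(p, x, y, q)], by simp [conjCommutator]⟩

theorem NowhereScattered.exists_norm_sub_list_sum_lt_one {A : Type*} [NonUnitalCStarAlgebra A]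
    [PartialOrder A] [StarOrderedRing A] (hA : NowhereScattered A) {b : A} (hb : 0 ≤ b) :
    ∃ (k : A) (l : List (A × A × A × A)),
      ‖b * k * b - b * k * b * b - b * b - (l.map (conjCommutator b)).sum‖ < 1 := by
  obtain ⟨H, hHc, hHh, hbH, hH⟩ :=
    NonUnitalStarSubalgebra.exists_hereditary_mem_closure_range hb
  have hchar : ∀ φ : H →⋆ₙₐ[ℂ] ℂ, φ = 0 := fun φ ↦ by
    by_contra h
    exact hA H hHc hHh ⟨φ, h⟩
  have := hHc
  let β : H := ⟨b, hbH⟩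
  obtain ⟨v, hv⟩ := exists_mul_one_sub_inr_mem_closure hchar β
  let T : Unitization ℂ H →+ A :=
    { toFun := fun j ↦ ((β * j * β : Unitization ℂ H).snd : H)
      map_zero' := by simp
      map_add' := fun x y ↦ by simp [mul_add, add_mul] }
  have hT : Continuous T := by
    change Continuous fun j ↦ (((β * j * β : Unitization ℂ H).snd : H) : A)
    exact continuous_subtype_val.comp (Unitization.continuous_snd.comp (by fun_prop))
  set Z := Set.range fun l : List (A × A × A × A) ↦ (l.map (conjCommutator b)).sum
  have hZ0 : (0 : A) ∈ Z := ⟨[], by simp⟩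
  have hZadd : ∀ x ∈ closure Z, ∀ y ∈ closure Z, x + y ∈ closure Z := fun x hx y hy ↦
    map_mem_closure₂ continuous_add hx hy (by
      rintro _ ⟨l, rfl⟩ _ ⟨m, rfl⟩
      exact ⟨l ++ m, by simp⟩)
  have hcomm : ∀ j ∈ Ideal.span {c : Unitization ℂ H | ∃ x y z, c = (x * y - y * x) * z},
      ∀ r, T (r * j) ∈ closure Z := fun j hj ↦ by
    induction hj using Submodule.span_induction with
    | mem j h =>
      rintro r
      obtain ⟨x, y, z, rfl⟩ := h
      have : T (r * ((x * y - y * x) * z)) =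
          (((β * r : Unitization ℂ H).snd : H) : A) * ((x.snd : A) * y.snd - y.snd * x.snd) *
            (((z * β : Unitization ℂ H).snd : H) : A) := by
        have hβ (r : Unitization ℂ H) : (∃ p : H, (β : Unitization ℂ H) * r = p) ∧
            ∃ q : H, r * (β : Unitization ℂ H) = q :=
          ⟨⟨((β : Unitization ℂ H) * r).snd, by ext <;> simp⟩,
            ⟨(r * (β : Unitization ℂ H)).snd, by ext <;> simp⟩⟩
        obtain ⟨p, hp⟩ := (hβ r).1
        obtain ⟨q, hq⟩ := (hβ z).2
        have h4 : (β : Unitization ℂ H) * (r * ((x * y - y * x) * z)) * β =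
            (β * r) * (x * y - y * x) * (z * β) := by simp only [mul_assoc]
        change (((β * (r * ((x * y - y * x) * z)) * β : Unitization ℂ H).snd : H) : A) = _
        rw [h4, hp, hq, Unitization.commutator_eq_inr, ← Unitization.inr_mul,
          ← Unitization.inr_mul]
        simp only [Unitization.snd_inr]
        rfl
      rw [this]
      exact closure_range_list_sum_conjCommutator b (hH _ (SetLike.coe_mem _))
        (hH _ (SetLike.coe_mem _)) (hH _ (SetLike.coe_mem _)) (hH _ (SetLike.coe_mem _))
    | zero => intro r; simpa using subset_closure hZ0
    | add x y _ _ hx hy => intro r; rw [mul_add, map_add]; exact hZadd _ (hx r) _ (hy r)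
    | smul a x _ hx => intro r; rw [smul_eq_mul, ← mul_assoc]; exact hx _
  have hTv : T (v * (1 - β) - 1) ∈ closure Z := by
    have := map_mem_closure hT hv (t := closure Z) fun j hj ↦ by simpa using hcomm j hj 1
    rwa [closure_closure] at this
  have hTeq : T (v * (1 - β) - 1) = T v - T v * b - b * b := by
    have h1 : T (v * β) = T v * b := by
      have h2 : ((β : Unitization ℂ H) * v * β) = (((β : Unitization ℂ H) * v * β).snd : H) := by
        ext <;> simp
      change (((β * (v * β) * β : Unitization ℂ H).snd : H) : A) =
        (((β * v * β : Unitization ℂ H).snd : H) : A) * (β : H)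
      rw [← mul_assoc, h2, ← Unitization.inr_mul]
      simp
    have h3 : T 1 = b * b := by
      change (((β * 1 * β : Unitization ℂ H).snd : H) : A) = (β : H) * (β : H)
      rw [mul_one, ← Unitization.inr_mul]
      simp
    rw [mul_sub, mul_one, map_sub, map_sub, h1, h3]
  rw [hTeq] at hTv
  have hTvH : T v ∈ closure (Set.range fun y ↦ b * y * b) :=
    hH _ (β * v * β : Unitization ℂ H).snd.2
  have := map_mem_closure₂ (f := fun k z : A ↦ k - k * b - b * b - z)
    (u := {x | ∃ (k : A) (l : List (A × A × A × A)),
      x = b * k * b - b * k * b * b - b * b - (l.map (conjCommutator b)).sum})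
    (by fun_prop) hTvH hTv (by
      rintro _ ⟨k, rfl⟩ _ ⟨l, rfl⟩
      exact ⟨k, l, rfl⟩)
  rw [sub_self] at this
  obtain ⟨_, ⟨k, l, rfl⟩, h⟩ := Metric.mem_closure_iff.1 this 1 one_pos
  exact ⟨k, l, by rwa [dist_zero_left] at h⟩

theorem CStarAlgebra.span_range_star_mul_self (A : Type*) [NonUnitalCStarAlgebra A] :
    Submodule.span ℂ (Set.range fun y : A ↦ star y * y) = ⊤ := by
  let _ := CStarAlgebra.spectralOrder A
  have := CStarAlgebra.spectralOrderedRing A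
  rw [eq_top_iff, ← CStarAlgebra.span_nonneg]
  refine Submodule.span_mono fun a ha ↦ ?_
  obtain ⟨y, rfl⟩ := CStarAlgebra.nonneg_iff_eq_star_mul_self.1 (show 0 ≤ a from ha)
  exact ⟨y, rfl⟩

theorem NonUnitalStarSubalgebra.Hereditary.conj_mem {A : Type*} [NonUnitalCStarAlgebra A]
    [PartialOrder A] [StarOrderedRing A] {B : NonUnitalStarSubalgebra ℂ A}
    (hB : IsClosed (B : Set A)) {H : NonUnitalStarSubalgebra ℂ B} (hH : H.Hereditary) {b : B}
    (hb : b ∈ H) (hbsa : star b = b) (x : B) : b * x * b ∈ H := by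
  have := hB
  have hx : x ∈ Submodule.span ℂ (Set.range fun y : B ↦ star y * y) := by
    rw [CStarAlgebra.span_range_star_mul_self]
    trivial
  induction hx using Submodule.span_induction with
  | mem x h =>
    obtain ⟨y, rfl⟩ := h
    have hle : star (b : A) * (star (y : A) * y) * b ≤ ‖star (y : A) * y‖ • (star (b : A) * b) :=
      CStarAlgebra.star_left_conjugate_le_norm_smul (.star_mul_self _)
    have hnn : 0 ≤ star (b : A) * (star (y : A) * y) * b :=
      star_left_conjugate_nonneg (star_mul_self_nonneg _) _
    have hb' : star (b : A) = b := congr_arg Subtype.val hbsa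
    rw [hb'] at hle hnn
    refine hH ((‖star (y : A) * y‖ : ℂ) • (b * b)) (SMulMemClass.smul_mem _ (H.mul_mem hb hb)) _ hnn ?_
    change (b : A) * (star (y : A) * y) * b ≤ (‖star (y : A) * y‖ : ℂ) • ((b : A) * b)
    rwa [Complex.coe_smul]
  | zero => simp
  | add x y _ _ hx hy => rw [mul_add, add_mul]; exact H.add_mem hx hy
  | smul c x _ hx => rw [mul_smul_comm, smul_mul_assoc]; exact SMulMemClass.smul_mem c hx

theorem NonUnitalStarSubalgebra.nowhereScattered_of_norm_sub_list_sum_lt_one {A : Type*}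
    [NonUnitalCStarAlgebra A] [PartialOrder A] [StarOrderedRing A]
    {B : NonUnitalStarSubalgebra ℂ A} (hB : IsClosed (B : Set A))
    (h : ∀ a ∈ B, ∃ (k : A) (l : List (A × A × A × A)), k ∈ B ∧
      (∀ w ∈ l, w.1 ∈ B ∧ w.2.1 ∈ B ∧ w.2.2.1 ∈ B ∧ w.2.2.2 ∈ B) ∧
      ‖star a * a * k * (star a * a) - star a * a * k * (star a * a) * (star a * a) -
        star a * a * (star a * a) - (l.map (conjCommutator (star a * a))).sum‖ < 1) :
    NowhereScattered B := by
  rintro H hH hher ⟨φ, hφ⟩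
  have := hB
  have := hH
  obtain ⟨a₀, ha₀⟩ : ∃ a, φ a ≠ 0 := by
    by_contra! h0
    exact hφ (NonUnitalStarAlgHom.ext h0)
  obtain ⟨a, ha⟩ : ∃ a, φ a = 1 := ⟨(φ a₀)⁻¹ • a₀, by simp [ha₀]⟩
  obtain ⟨k, l, hk, hl, hlt⟩ := h (a : B) (a : B).2
  set b : H := star a * a with hb
  have hφb : φ b = 1 := by rw [hb, map_mul, map_star, ha]; simp
  have hbA : star ((a : B) : A) * ((a : B) : A) = ((b : B) : A) := rfl
  rw [hbA] at hlt
  have hconj : ∀ x ∈ B, ∃ y : H, ((y : B) : A) = ((b : B) : A) * x * ((b : B) : A) :=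
    fun x hx ↦ ⟨⟨(b : B) * ⟨x, hx⟩ * b, hher.conj_mem hB b.2
      (congr_arg Subtype.val (show star b = b by simp [hb])) _⟩, rfl⟩
  have hsum : ∃ s : H, φ s = 0 ∧
      ((s : B) : A) = (l.map (conjCommutator ((b : B) : A))).sum := by
    clear hlt
    induction l with
    | nil => exact ⟨0, map_zero φ, by simp⟩
    | cons w l ih =>
      obtain ⟨s, hs0, hs⟩ := ih fun w hw ↦ hl w (List.mem_cons_of_mem _ hw)
      obtain ⟨h1, h2, h3, h4⟩ := hl w List.mem_cons_self
      obtain ⟨p, hp⟩ := hconj _ h1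
      obtain ⟨x, hx⟩ := hconj _ h2
      obtain ⟨y, hy⟩ := hconj _ h3
      obtain ⟨q, hq⟩ := hconj _ h4
      refine ⟨p * (x * y - y * x) * q + s, ?_, ?_⟩
      · simp [hs0, mul_comm (φ x)]
      · rw [List.map_cons, List.sum_cons, ← hs, conjCommutator, ← hp, ← hx, ← hy, ← hq]
        rfl
  obtain ⟨s, hs0, hs⟩ := hsum
  obtain ⟨m, hm⟩ := hconj k hk
  rw [← hs, ← hm] at hlt
  have hle : ‖φ (m - m * b - b * b - s)‖ ≤ ‖m - m * b - b * b - s‖ :=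
    NonUnitalStarAlgHom.norm_apply_le φ _
  have hval : φ (m - m * b - b * b - s) = -1 := by simp [hs0, hφb]
  rw [hval, norm_neg, norm_one] at hle
  exact absurd (hle.trans_lt hlt) (lt_irrefl _)

open TopologicalSpace in
theorem exists_separable_nowhereScattered {A : Type*} [NonUnitalCStarAlgebra A]
    [PartialOrder A] [StarOrderedRing A] (hA : NowhereScattered A)
    (B₀ : NonUnitalStarSubalgebra ℂ A) (hB₀closed : IsClosed (B₀ : Set A))
    (hB₀sep : IsSeparable (B₀ : Set A)) :
    ∃ B : NonUnitalStarSubalgebra ℂ A, IsClosed (B : Set A) ∧ IsSeparable (B : Set A) ∧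
      NowhereScattered B ∧ B₀ ≤ B := by
  let R : A → A × List (A × A × A × A) → Prop := fun a w ↦
    ‖star a * a * w.1 * (star a * a) - star a * a * w.1 * (star a * a) * (star a * a) -
      star a * a * (star a * a) - (w.2.map (conjCommutator (star a * a))).sum‖ < 1
  let supp : A × List (A × A × A × A) → Set A := fun w ↦
    {w.1} ∪ ⋃ v ∈ {v | v ∈ w.2}, {v.1, v.2.1, v.2.2.1, v.2.2.2}
  have hsupp : ∀ w, (supp w).Countable := fun w ↦
    (Set.countable_singleton _).union
      ((List.finite_toSet w.2).countable.biUnion fun v _ ↦ Set.to_countable _)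
  have hopen : ∀ w, IsOpen {a | R a w} := fun w ↦ by
    have : Continuous fun a : A ↦ (w.2.map fun v ↦ conjCommutator (star a * a) v).sum :=
      continuous_list_sum _ fun v _ ↦ by
        unfold conjCommutator
        fun_prop
    exact isOpen_lt (by fun_prop) continuous_const
  obtain ⟨B, hBc, hBs, hle, hB⟩ := NonUnitalStarSubalgebra.exists_isSeparable_witnesses
    supp hsupp R hopen (fun a ↦ by
      obtain ⟨k, l, h⟩ := hA.exists_norm_sub_list_sum_lt_one (star_mul_self_nonneg a)
      exact ⟨(k, l), h⟩) B₀ hB₀sep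
  refine ⟨B, hBc, hBs, ?_, hle⟩
  refine B.nowhereScattered_of_norm_sub_list_sum_lt_one hBc fun a ha ↦ ?_
  obtain ⟨⟨k, l⟩, hw, h⟩ := hB a ha
  refine ⟨k, l, hw (Or.inl rfl), fun v hv ↦ ?_, h⟩
  have hv' : ∀ x ∈ ({v.1, v.2.1, v.2.2.1, v.2.2.2} : Set A), x ∈ B := fun x hx ↦
    hw (Or.inr (Set.mem_biUnion (show v ∈ {v | v ∈ l} from hv) hx))
  exact ⟨hv' _ (by simp), hv' _ (by simp), hv' _ (by simp), hv' _ (by simp)⟩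
end

section
/- Let S be a Cu-semigroup. Then S satisfies (O8) if and only if for all x', x, y', y, z, w ∈ S with 2w = w, x + y ≪ z + w, x' ≪ x, and y' ≪ y, there exist z₁, z₂ ∈ S such that z₁ + z₂ ≤ z, x' ≤ z₁ + w, y' ≤ z₂ + w, z₁ ≤ x + w, and z₂ ≤ y + w. -/
variable {S : Type*} [AddCommMonoid S] [PartialOrder S]

/-- The (sequential) way-below relation: `x ≪ y` if for every increasing sequence whose
supremum dominates `y`, some member of the sequence dominates `x`. -/
def WayBelow (x y : S) : Prop :=
  ∀ f : ℕ → S, Monotone f → ∀ s : S, IsLUB (Set.range f) s → y ≤ s → ∃ n, x ≤ f n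

/-- A Cu-semigroup (abstract Cuntz semigroup): a positively ordered commutative monoid
satisfying the axioms (O1)-(O4). -/
structure IsCuSemigroup (S : Type*) [AddCommMonoid S] [PartialOrder S] : Prop where
  zero_le : ∀ x : S, 0 ≤ x
  add_le_add : ∀ {a b c d : S}, a ≤ b → c ≤ d → a + c ≤ b + d
  O1 : ∀ f : ℕ → S, Monotone f → ∃ s : S, IsLUB (Set.range f) s
  O2 : ∀ x : S, ∃ f : ℕ → S, (∀ n, WayBelow (f n) (f (n + 1))) ∧ IsLUB (Set.range f) x
  O3 : ∀ {x' x y' y : S}, WayBelow x' x → WayBelow y' y → WayBelow (x' + y') (x + y)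
  O4 : ∀ f g : ℕ → S, Monotone f → Monotone g → ∀ s t : S, IsLUB (Set.range f) s →
    IsLUB (Set.range g) t → IsLUB (Set.range fun n => f n + g n) (s + t)

/-- Axiom (O5) for Cu-semigroups. -/
def AxiomO5 (S : Type*) [AddCommMonoid S] [PartialOrder S] : Prop :=
  ∀ x' x y' y z : S, x + y ≤ z → WayBelow x' x → WayBelow y' y →
    ∃ c : S, x' + c ≤ z ∧ z ≤ x + c ∧ WayBelow y' c

/-- Axiom (O6) for Cu-semigroups. -/
def AxiomO6 (S : Type*) [AddCommMonoid S] [PartialOrder S] : Prop :=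
  ∀ x' x y z : S, WayBelow x' x → x ≤ y + z →
    ∃ e f : S, x' ≤ e + f ∧ e ≤ x ∧ e ≤ y ∧ f ≤ x ∧ f ≤ z

/-- Axiom (O8) for Cu-semigroups. -/
def AxiomO8 (S : Type*) [AddCommMonoid S] [PartialOrder S] : Prop :=
  ∀ x' x y' y z w : S, 2 • w = w → WayBelow (x + y) (z + w) → WayBelow x' x → WayBelow y' y →
    ∃ z₁ z₂ : S, WayBelow (z₁ + z₂) z ∧ WayBelow x' (z₁ + w) ∧ WayBelow y' (z₂ + w) ∧
      WayBelow z₁ (x + w) ∧ WayBelow z₂ (y + w)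

/-- A Cu-semigroup is weakly cancellative if `x + z ≪ y + z` implies `x ≪ y`. -/
def WeaklyCancellative (S : Type*) [AddCommMonoid S] [PartialOrder S] : Prop :=
  ∀ x y z : S, WayBelow (x + z) (y + z) → WayBelow x y

/-- An element `x` is weakly `(k,ω)`-divisible. -/
def IsWeaklyDivisible (k : ℕ) (x : S) : Prop :=
  ∀ x' : S, WayBelow x' x → ∃ (n : ℕ) (y : Fin n → S),
    (∀ j, k • y j ≤ x) ∧ x' ≤ ∑ j, y j

/-- An element `x` is `(k,ω)`-divisible. -/
def IsDivisible (k : ℕ) (x : S) : Prop :=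
  ∀ x' : S, WayBelow x' x → ∃ (n : ℕ) (y : S), k • y ≤ x ∧ x' ≤ n • y

/-- The interval axiom for Cu-semigroups. -/
def IntervalAxiom (S : Type*) [AddCommMonoid S] [PartialOrder S] : Prop :=
  ∀ x' x y u v : S, WayBelow x' x → WayBelow x (y + u) → WayBelow x (y + v) →
    ∃ w : S, WayBelow x' (y + w) ∧ WayBelow w u ∧ WayBelow w v

/-- The Riesz Interpolation Property. -/
def RieszInterpolation (S : Type*) [AddCommMonoid S] [PartialOrder S] : Prop :=
  ∀ x₁ x₂ y₁ y₂ : S, x₁ ≤ y₁ → x₁ ≤ y₂ → x₂ ≤ y₁ → x₂ ≤ y₂ →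
    ∃ z : S, x₁ ≤ z ∧ x₂ ≤ z ∧ z ≤ y₁ ∧ z ≤ y₂

/-- A Cu-semigroup is countably based if there is a countable subset such that every
element is the supremum of an increasing sequence from that subset. -/
def CountablyBased (S : Type*) [AddCommMonoid S] [PartialOrder S] : Prop :=
  ∃ B : Set S, B.Countable ∧ ∀ x : S, ∃ f : ℕ → S,
    Monotone f ∧ (∀ n, f n ∈ B) ∧ IsLUB (Set.range f) x

/-- A Cu-semigroup is inf-semilattice ordered if finite infima exist and addition
distributes over them. -/
def InfSemilatticeOrdered (S : Type*) [AddCommMonoid S] [PartialOrder S] : Prop :=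
  (∀ x y : S, ∃ m : S, IsGLB {x, y} m) ∧
    ∀ x y z m : S, IsGLB {x, y} m → IsGLB {x + z, y + z} (m + z)

theorem WayBelow.le {T : Type*} [PartialOrder T] {x y : T} (h : WayBelow x y) : x ≤ y := by
  obtain ⟨_, hn⟩ := h (fun _ => y) monotone_const y (by simp) le_rfl
  exact hn

theorem WayBelow.trans_le {T : Type*} [PartialOrder T] {x y z : T}
    (h : WayBelow x y) (hyz : y ≤ z) : WayBelow x z :=
  fun f hf s hs hz => h f hf s hs (hyz.trans hz)

theorem LE.le.trans_wayBelow {T : Type*} [PartialOrder T] {x y z : T}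
    (hxy : x ≤ y) (h : WayBelow y z) : WayBelow x z :=
  fun f hf s hs hz => (h f hf s hs hz).imp fun _ hn => hxy.trans hn

theorem IsCuSemigroup.exists_wayBelow_between (hS : IsCuSemigroup S) {x y : S}
    (h : WayBelow x y) : ∃ u : S, WayBelow x u ∧ WayBelow u y := by
  obtain ⟨f, hf, hfy⟩ := hS.O2 y
  obtain ⟨n, hn⟩ := h f (monotone_nat_of_le_succ fun n => (hf n).le) y hfy le_rfl
  exact ⟨f (n + 1), hn.trans_wayBelow (hf n), (hf (n + 1)).trans_le (hfy.1 ⟨n + 2, rfl⟩)⟩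

theorem IsCuSemigroup.exists_wayBelow_left_summand (hS : IsCuSemigroup S) {x z w : S}
    (h : WayBelow x (z + w)) : ∃ z' : S, WayBelow z' z ∧ WayBelow x (z' + w) := by
  obtain ⟨u, hxu, hu⟩ := hS.exists_wayBelow_between h
  obtain ⟨f, hf, hfz⟩ := hS.O2 z
  have hmono : Monotone f := monotone_nat_of_le_succ fun n => (hf n).le
  obtain ⟨n, hn⟩ := hu (fun n => f n + w)
    (fun _ _ hmn => hS.add_le_add (hmono hmn) le_rfl) (z + w)
    (hS.O4 f (fun _ => w) hmono monotone_const z w hfz (by simp)) le_rfl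
  exact ⟨f n, (hf n).trans_le (hfz.1 ⟨n + 1, rfl⟩), hxu.trans_le hn⟩

theorem axiomO8_iff_le_version (S : Type*) [AddCommMonoid S] [PartialOrder S]
    (hS : IsCuSemigroup S) :
    AxiomO8 S ↔
      ∀ x' x y' y z w : S, 2 • w = w → WayBelow (x + y) (z + w) → WayBelow x' x →
        WayBelow y' y →
        ∃ z₁ z₂ : S, z₁ + z₂ ≤ z ∧ x' ≤ z₁ + w ∧ y' ≤ z₂ + w ∧
          z₁ ≤ x + w ∧ z₂ ≤ y + w := by
  constructor
  · intro h x' x y' y z w hw hxy hx hy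
    obtain ⟨z₁, z₂, hz, h₁, h₂, h₃, h₄⟩ := h x' x y' y z w hw hxy hx hy
    exact ⟨z₁, z₂, hz.le, h₁.le, h₂.le, h₃.le, h₄.le⟩
  · intro h x' x y' y z w hw hxy hx hy
    obtain ⟨u, hxu, hux⟩ := hS.exists_wayBelow_between hx
    obtain ⟨v, hyv, hvy⟩ := hS.exists_wayBelow_between hy
    obtain ⟨z₁, z₂, hz, h₁, h₂, h₃, h₄⟩ := h u x v y z w hw hxy hux hvy
    obtain ⟨c, hc, hxc⟩ := hS.exists_wayBelow_left_summand (hxu.trans_le h₁)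
    obtain ⟨d, hd, hyd⟩ := hS.exists_wayBelow_left_summand (hyv.trans_le h₂)
    exact ⟨c, d, (hS.O3 hc hd).trans_le hz, hxc, hyd, hc.trans_le h₃, hd.trans_le h₄⟩
end

section
/- Let S be a weakly cancellative Cu-semigroup satisfying (O5) and (O6). Then S satisfies (O8). -/
variable {S : Type*} [AddCommMonoid S] [PartialOrder S]

namespace WayBelow

theorem trans_le_s12 {T : Type*} [PartialOrder T] {a b c : T} (h : WayBelow a b) (hbc : b ≤ c) : WayBelow a c :=
  fun f hf s hs hcs => h f hf s hs (hbc.trans hcs)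

theorem le_trans {T : Type*} [PartialOrder T] {a b c : T} (hab : a ≤ b) (h : WayBelow b c) : WayBelow a c :=
  fun f hf s hs hcs => (h f hf s hs hcs).imp fun _ hn => hab.trans hn

theorem le_s12 {T : Type*} [PartialOrder T] {a b : T} (h : WayBelow a b) : a ≤ b := by
  obtain ⟨_, hn⟩ := h (fun _ => b) monotone_const b (by simp) le_rfl
  exact hn

end WayBelow

namespace IsCuSemigroup

theorem le_add_right (hS : IsCuSemigroup S) (a b : S) : a ≤ a + b := by
  simpa using hS.add_le_add (le_refl a) (hS.zero_le b)

theorem zero_wayBelow (hS : IsCuSemigroup S) (a : S) : WayBelow 0 a :=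
  fun f _ _ _ _ => ⟨0, hS.zero_le (f 0)⟩

/-- The way-below relation interpolates. -/
theorem exists_between (hS : IsCuSemigroup S) {a b : S} (h : WayBelow a b) :
    ∃ m : S, WayBelow a m ∧ WayBelow m b := by
  obtain ⟨f, hf, hb⟩ := hS.O2 b
  obtain ⟨n, hn⟩ := h f (monotone_nat_of_le_succ fun n => (hf n).le_s12) b hb le_rfl
  exact ⟨f (n + 1), WayBelow.le_trans hn (hf n), (hf (n + 1)).trans_le_s12 (hb.1 ⟨n + 2, rfl⟩)⟩

theorem exists_wayBelow_add (hS : IsCuSemigroup S) {a e w : S} (h : WayBelow a (e + w)) :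
    ∃ e' : S, WayBelow e' e ∧ WayBelow a (e' + w) := by
  obtain ⟨m, ham, hm⟩ := hS.exists_between h
  obtain ⟨f, hf, he⟩ := hS.O2 e
  have hmono : Monotone f := monotone_nat_of_le_succ fun n => (hf n).le_s12
  obtain ⟨n, hn⟩ := hm (fun n => f n + w) (fun _ _ hij => hS.add_le_add (hmono hij) le_rfl)
    (e + w) (hS.O4 f (fun _ => w) hmono monotone_const e w he (by simp)) le_rfl
  exact ⟨f n, (hf n).trans_le_s12 (he.1 ⟨n + 1, rfl⟩), ham.trans_le_s12 hn⟩

/-- A one-sided form of (O6) with the first summand approximated from below. -/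
theorem exists_wayBelow_of_le_add (hS : IsCuSemigroup S) (h6 : AxiomO6 S) {x' x y w : S}
    (hx : WayBelow x' x) (hle : x ≤ y + w) :
    ∃ e' e : S, WayBelow e' e ∧ e ≤ x ∧ e ≤ y ∧ WayBelow x' (e' + w) := by
  obtain ⟨m, hxm, hm⟩ := hS.exists_between hx
  obtain ⟨e, f, hef, hex, hey, -, hfw⟩ := h6 m x y w hm hle
  obtain ⟨e', he', hxe⟩ := hS.exists_wayBelow_add
    (hxm.trans_le_s12 (hef.trans (hS.add_le_add le_rfl hfw)))
  exact ⟨e', e, he', hex, hey, hxe⟩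

end IsCuSemigroup

theorem axiomO8_of_weaklyCancellative (S : Type*) [AddCommMonoid S] [PartialOrder S]
    (hS : IsCuSemigroup S) (hwc : WeaklyCancellative S) (h5 : AxiomO5 S) (h6 : AxiomO6 S) :
    AxiomO8 S := by
  intro x' x y' y z w _ hxy hx hy
  have hxle : x ≤ z + w := (hS.le_add_right x y).trans hxy.le_s12
  obtain ⟨z₁, e, hz₁, hex, hez, hx₁⟩ := hS.exists_wayBelow_of_le_add h6 hx hxle
  obtain ⟨m, hzm, hme⟩ := hS.exists_between hz₁
  obtain ⟨c, hcz, hzc, -⟩ := h5 m e 0 0 z (by simpa using hez) hme (hS.zero_wayBelow 0)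
  have hyc : WayBelow y (c + w) := by
    refine hwc y (c + w) x ?_
    rw [add_comm y x, add_comm (c + w) x, ← add_assoc]
    exact hxy.trans_le_s12 (hS.add_le_add (hzc.trans (hS.add_le_add hex le_rfl)) le_rfl)
  obtain ⟨z₂, g, hz₂, hgy, hgc, hy₂⟩ := hS.exists_wayBelow_of_le_add h6 hy hyc.le_s12
  exact ⟨z₁, z₂, (hS.O3 hzm hz₂).trans_le_s12 ((hS.add_le_add le_rfl hgc).trans hcz), hx₁, hy₂,
    hz₁.trans_le_s12 (hex.trans (hS.le_add_right x w)),
    hz₂.trans_le_s12 (hgy.trans (hS.le_add_right y w))⟩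
end
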